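/- arXiv:1905.00340 — 6 statements merged into one kernel-verified Lean document; each statement's English description precedes it below -/
import Mathlib

section
/- Let S and R be independent sets of a finite simple graph G with |S| = |R| ≥ 1. Then R is TJ-reachable from S in G if and only if S ↭_{|S|−1} R. -/
open Finset

variable {V : Type*}

/-- `S` is an independent set of the simple graph `G`. -/
def IndepF (G : SimpleGraph V) (S : Finset V) : Prop :=
  ∀ u ∈ S, ∀ v ∈ S, ¬ G.Adj u v

/-- A single `TAR_k` step inside the induced subgraph `G[W]`:
both sets are independent sets of `G` contained in `W`, their symmetric
difference has at most one element, and both have size at least `k`. -/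
def TarStepOn [DecidableEq V] (G : SimpleGraph V) (W : Set V) (k : ℤ)
    (A B : Finset V) : Prop :=
  (A : Set V) ⊆ W ∧ (B : Set V) ⊆ W ∧ IndepF G A ∧ IndepF G B ∧
    (symmDiff A B).card ≤ 1 ∧ k ≤ (A.card : ℤ) ∧ k ≤ (B.card : ℤ)

/-- `TAR_k` reachability inside the induced subgraph `G[W]`. -/
def TarReachOn [DecidableEq V] (G : SimpleGraph V) (W : Set V) (k : ℤ) :
    Finset V → Finset V → Prop :=
  Relation.ReflTransGen (TarStepOn G W k)

/-- A single token-sliding step inside the induced subgraph `G[W]`. -/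
def TsStepOn [DecidableEq V] (G : SimpleGraph V) (W : Set V) (A B : Finset V) : Prop :=
  (A : Set V) ⊆ W ∧ (B : Set V) ⊆ W ∧ IndepF G A ∧ IndepF G B ∧
    ∃ x y, G.Adj x y ∧ symmDiff A B = {x, y}

/-- Token-sliding (`TS`) reachability inside the induced subgraph `G[W]`. -/
def TsReachOn [DecidableEq V] (G : SimpleGraph V) (W : Set V) :
    Finset V → Finset V → Prop :=
  Relation.ReflTransGen (TsStepOn G W)

/-- `M` is a module of `G`. -/
def IsModule [DecidableEq V] (G : SimpleGraph V) (M : Finset V) : Prop :=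
  ∀ u ∈ M, ∀ v ∈ M, ∀ w, w ∉ M → (G.Adj u w ↔ G.Adj v w)

/-- The open neighborhood `N(M)` of the vertex set `M`: vertices outside `M`
adjacent to some vertex of `M`. -/
def NbhdSet (G : SimpleGraph V) (M : Finset V) : Set V :=
  {w | w ∉ M ∧ ∃ v ∈ M, G.Adj v w}

/-- `lam G W S k` : the largest size of an independent set reachable from `S`
under `TAR_k` inside the induced subgraph `G[W]`. -/
noncomputable def lam [DecidableEq V] (G : SimpleGraph V) (W : Set V)
    (S : Finset V) (k : ℤ) : ℕ :=
  sSup {n | ∃ T : Finset V, TarReachOn G W k S T ∧ T.card = n}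

/-- A single token-jumping step: both sets are independent, of equal size,
and their symmetric difference has exactly two elements. -/
def TjStep [DecidableEq V] (G : SimpleGraph V) (A B : Finset V) : Prop :=
  IndepF G A ∧ IndepF G B ∧ A.card = B.card ∧ (symmDiff A B).card = 2

/-- Token-jumping (`TJ`) reachability. -/
def TjReach [DecidableEq V] (G : SimpleGraph V) : Finset V → Finset V → Prop :=
  Relation.ReflTransGen (TjStep G)

lemma IndepF.mono {V : Type*} {G : SimpleGraph V} {A B : Finset V} (hB : IndepF G B)
    (h : A ⊆ B) : IndepF G A :=
  fun u hu v hv => hB u (h hu) v (h hv)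

/-- Two independent sets of equal size that both arise by adding one vertex to a common set are
TJ-reachable from one another. -/
lemma TjReach.of_insert {V : Type*} [DecidableEq V] {G : SimpleGraph V} {C : Finset V} {u v : V}
    (hu : u ∉ C) (hv : v ∉ C) (hA : IndepF G (insert u C)) (hB : IndepF G (insert v C)) :
    TjReach G (insert u C) (insert v C) := by
  by_cases huv : u = v
  · subst huv
    exact Relation.ReflTransGen.refl
  · refine Relation.ReflTransGen.single ⟨hA, hB, ?_, ?_⟩
    · rw [card_insert_of_notMem hu, card_insert_of_notMem hv]
    · have : symmDiff (insert u C) (insert v C) = {u, v} := by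
        ext x
        simp only [mem_symmDiff, mem_insert, mem_singleton]
        grind
      rw [this, card_pair huv]

/-- Along a TAR sequence with threshold `|S| - 1` starting at `S`, every independent set of size
`|S|` comparable with the current set is TJ-reachable from `S`. -/
lemma TarReachOn.tjReach_of_comparable {V : Type*} [DecidableEq V] {G : SimpleGraph V}
    {S A : Finset V} (h : TarReachOn G Set.univ ((S.card : ℤ) - 1) S A) :
    ∀ T : Finset V, IndepF G T → T.card = S.card → (T ⊆ A ∨ A ⊆ T) → TjReach G S T := by
  induction h with
  | refl =>
    rintro T - hT (h | h)
    · rw [eq_of_subset_of_card_le h hT.ge]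
      exact Relation.ReflTransGen.refl
    · rw [← eq_of_subset_of_card_le h hT.le]
      exact Relation.ReflTransGen.refl
  | @tail A B _ hstep ih =>
    intro T hTi hT hTB
    obtain ⟨-, -, hA, hB, hd, hkA, hkB⟩ := hstep
    rcases Nat.le_one_iff_eq_zero_or_eq_one.mp hd with hd | hd
    · have hAB : A = B := by simpa using hd
      exact ih T hTi hT (hAB ▸ hTB)
    obtain ⟨v, hv⟩ := card_eq_one.mp hd
    have hmem : ∀ x, (x ∈ A ∧ x ∉ B ∨ x ∈ B ∧ x ∉ A) ↔ x = v := fun x => by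
      rw [← mem_symmDiff, hv, mem_singleton]
    by_cases hvA : v ∈ A
    · have hvB : v ∉ B := by have := hmem v; tauto
      have hAeq : A = insert v B := by
        ext x
        have := hmem x
        grind
      rcases hTB with hTB | hBT
      · exact ih T hTi hT (Or.inl (hTB.trans (hAeq ▸ subset_insert v B)))
      · have hcA : A.card = B.card + 1 := by rw [hAeq, card_insert_of_notMem hvB]
        have hle := card_le_card hBT
        by_cases hBT' : T.card ≤ B.card
        · rw [← eq_of_subset_of_card_le hBT hBT'] at hT ⊢
          exact ih B hB hT (Or.inl (hAeq ▸ subset_insert v B))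
        · have hc : B.card + 1 = T.card := by omega
          obtain ⟨w, hw, rfl⟩ := exists_eq_insert_iff.mpr ⟨hBT, hc⟩
          have hSA := ih A hA (by omega) (Or.inl subset_rfl)
          rw [hAeq] at hSA hA
          exact hSA.trans (TjReach.of_insert hvB hw hA hTi)
    · have hvB : v ∈ B := by have := hmem v; tauto
      have hBeq : B = insert v A := by
        ext x
        have := hmem x
        grind
      have hcB : B.card = A.card + 1 := by rw [hBeq, card_insert_of_notMem hvA]
      have hTB' : T ⊆ B := by
        rcases hTB with h | h
        · exact h
        · rw [eq_of_subset_of_card_le h (by omega)]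
      by_cases hvT : v ∈ T
      · have hsub : T.erase v ⊆ A := subset_insert_iff.mp (hBeq ▸ hTB')
        have hce := card_erase_add_one hvT
        by_cases hlt : (T.erase v).card < A.card
        · obtain ⟨u, huA, huT⟩ := exists_mem_notMem_of_card_lt_card hlt
          have hUA : insert u (T.erase v) ⊆ A := insert_subset huA hsub
          have hSU := ih _ (hA.mono hUA) (by rw [card_insert_of_notMem huT]; omega) (Or.inl hUA)
          have := TjReach.of_insert huT (notMem_erase v T) (hA.mono hUA)
            (by rwa [insert_erase hvT])
          rw [insert_erase hvT] at this
          exact hSU.trans this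
        · have := eq_of_subset_of_card_le hsub (by omega)
          exact ih T hTi hT (Or.inr (this ▸ erase_subset v T))
      · exact ih T hTi hT (Or.inl (by rw [hBeq] at hTB'; grind))

lemma TjStep.tarReachOn {V : Type*} [DecidableEq V] {G : SimpleGraph V} {A B : Finset V}
    (h : TjStep G A B) : TarReachOn G Set.univ ((A.card : ℤ) - 1) A B := by
  obtain ⟨hA, hB, hc, hd⟩ := h
  have h1 := card_sdiff_add_card_inter A B
  have h2 := card_sdiff_add_card_inter B A
  rw [inter_comm B A] at h2
  have h3 : (symmDiff A B).card = (A \ B).card + (B \ A).card :=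
    card_union_of_disjoint disjoint_sdiff_sdiff
  have hI : IndepF G (A ∩ B) := hA.mono inter_subset_left
  have e1 : symmDiff A (A ∩ B) = A \ B := by ext x; simp only [mem_symmDiff]; grind
  have e2 : symmDiff (A ∩ B) B = B \ A := by ext x; simp only [mem_symmDiff]; grind
  refine Relation.ReflTransGen.tail (b := A ∩ B) (Relation.ReflTransGen.single ?_) ?_
  · exact ⟨Set.subset_univ _, Set.subset_univ _, hA, hI, by rw [e1]; omega, by omega, by omega⟩
  · exact ⟨Set.subset_univ _, Set.subset_univ _, hI, hB, by rw [e2]; omega, by omega, by omega⟩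

lemma TjReach.card_eq {V : Type*} [DecidableEq V] {G : SimpleGraph V} {A B : Finset V}
    (h : TjReach G A B) : A.card = B.card := by
  induction h with
  | refl => rfl
  | tail _ hstep ih => exact ih.trans hstep.2.2.1

lemma TjReach.tarReachOn {V : Type*} [DecidableEq V] {G : SimpleGraph V} {A B : Finset V}
    (h : TjReach G A B) : TarReachOn G Set.univ ((A.card : ℤ) - 1) A B := by
  induction h with
  | refl => exact Relation.ReflTransGen.refl
  | tail hreach hstep ih =>
    have := hstep.tarReachOn
    rw [← TjReach.card_eq hreach] at this
    exact Relation.ReflTransGen.trans ih this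

/-- Let `S` and `R` be independent sets of a finite simple graph
`G` with `|S| = |R| ≥ 1`. Then `R` is `TJ`-reachable from `S` in `G` if and
only if `S ↭_{|S|-1} R`. -/
theorem stmt3 {V : Type*} [Fintype V] [DecidableEq V] (G : SimpleGraph V)
    (S R : Finset V) (hS : IndepF G S) (hR : IndepF G R)
    (hcard : S.card = R.card) (h1 : 1 ≤ S.card) :
    TjReach G S R ↔ TarReachOn G Set.univ ((S.card : ℤ) - 1) S R :=
  ⟨TjReach.tarReachOn, fun h => h.tjReach_of_comparable R hR hcard.symm (Or.inl subset_rfl)⟩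
end

section
/- Let G be a finite simple graph, S an independent set of G, k an integer, and M a module of G. Suppose there exists an independent set A ⊆ M of G such that (S ∩ M) ⊆ A and |A| = α(G[M]), i.e., A is a maximum independent set of the induced subgraph G[M]. Then for every vertex u ∈ M ∖ A, λ(G, S, k) = λ(G − u, S, k). -/
open Finset

variable {V : Type*}

theorem TarReachOn.mono [DecidableEq V] {G : SimpleGraph V} {W W' : Set V} (hW : W ⊆ W') {k : ℤ}
    {S T : Finset V} (h : TarReachOn G W k S T) : TarReachOn G W' k S T :=
  Relation.ReflTransGen.mono
    (fun _ _ ⟨hA, hB, hrest⟩ => ⟨hA.trans hW, hB.trans hW, hrest⟩) _ _ h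

/-- Replacing the part of an independent set inside a module by an independent subset of the module
of the same size preserves independence. -/
theorem IndepF.replace_module [DecidableEq V] {G : SimpleGraph V} {M S B : Finset V}
    (hS : IndepF G S) (hM : IsModule G M) (hBM : B ⊆ M) (hB : IndepF G B)
    (hcard : B.card = (S ∩ M).card) : IndepF G (S \ M ∪ B) := by
  have cross : ∀ x ∈ S \ M, ∀ y ∈ B, ¬ G.Adj y x := by
    intro x hx y hy hyx
    rw [mem_sdiff] at hx
    have hpos : 0 < (S ∩ M).card := hcard ▸ card_pos.2 ⟨y, hy⟩
    obtain ⟨z, hz⟩ := card_pos.1 hpos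
    rw [mem_inter] at hz
    exact hS z hz.1 x hx.1 ((hM y (hBM hy) z hz.2 x hx.2).1 hyx)
  intro x hx y hy hxy
  rcases mem_union.1 hx with hx | hx <;> rcases mem_union.1 hy with hy | hy
  · exact hS x (mem_sdiff.1 hx).1 y (mem_sdiff.1 hy).1 hxy
  · exact cross x hx y hy hxy.symm
  · exact cross y hy x hx hxy
  · exact hB x hx y hy hxy

theorem card_replace_module [DecidableEq V] {M S B : Finset V} (hBM : B ⊆ M)
    (hcard : B.card = (S ∩ M).card) : (S \ M ∪ B).card = S.card := by
  rw [card_union_of_disjoint (disjoint_of_subset_right hBM sdiff_disjoint), hcard,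
    card_sdiff_add_card_inter]

/-- A subset of `A` can be resized to any `n ≤ #A` by only adding or only removing elements. -/
theorem exists_subset_card_eq_symmDiff [DecidableEq V] {A B : Finset V} (hBA : B ⊆ A) {n : ℕ}
    (hn : n ≤ A.card) :
    ∃ C ⊆ A, C.card = n ∧ (symmDiff B C).card = (B.card - n) + (n - B.card) := by
  rcases le_total B.card n with h | h
  · obtain ⟨C, hBC, hCA, rfl⟩ := exists_subsuperset_card_eq hBA h hn
    refine ⟨C, hCA, rfl, ?_⟩
    rw [symmDiff_of_le hBC, card_sdiff_of_subset hBC]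
    omega
  · obtain ⟨C, hCB, rfl⟩ := exists_subset_card_eq h
    refine ⟨C, hCB.trans hBA, rfl, ?_⟩
    rw [symmDiff_of_ge hCB, card_sdiff_of_subset hCB]
    omega

theorem card_sub_add_card_sub_le_card_symmDiff [DecidableEq V] (S T : Finset V) :
    (S.card - T.card) + (T.card - S.card) ≤ (symmDiff S T).card := by
  have h : (symmDiff S T).card = (S \ T).card + (T \ S).card :=
    card_union_of_disjoint disjoint_sdiff_sdiff
  have := le_card_sdiff S T
  have := le_card_sdiff T S
  omega

theorem TarStepOn.exists_replace_module [DecidableEq V] {G : SimpleGraph V} {k : ℤ}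
    {S T M A B : Finset V} {u : V} (h : TarStepOn G Set.univ k S T) (hM : IsModule G M)
    (hAM : A ⊆ M) (hA : IndepF G A)
    (hAmax : ∀ B : Finset V, B ⊆ M → IndepF G B → B.card ≤ A.card)
    (huM : u ∈ M) (huA : u ∉ A) (hBA : B ⊆ A) (hB : B.card = (S ∩ M).card) :
    ∃ C ⊆ A, C.card = (T ∩ M).card ∧
      TarStepOn G ({u}ᶜ : Set V) k (S \ M ∪ B) (T \ M ∪ C) := by
  obtain ⟨-, -, hS, hT, hST, hkS, hkT⟩ := h
  obtain ⟨C, hCA, hC, hBC⟩ := exists_subset_card_eq_symmDiff hBA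
    (hAmax (T ∩ M) inter_subset_right fun x hx y hy =>
      hT x (mem_inter.1 hx).1 y (mem_inter.1 hy).1)
  have avoid : ∀ X D : Finset V, D ⊆ A → ((X \ M ∪ D : Finset V) : Set V) ⊆ {u}ᶜ := by
    rintro X D hD x hx rfl
    rcases mem_union.1 (mem_coe.1 hx) with hx | hx
    · exact (mem_sdiff.1 hx).2 huM
    · exact huA (hD hx)
  have indep_sub : ∀ D ⊆ A, IndepF G D := fun D hD x hx y hy => hA x (hD hx) y (hD hy)
  refine ⟨C, hCA, hC, avoid S B hBA, avoid T C hCA,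
    hS.replace_module hM (hBA.trans hAM) (indep_sub B hBA) hB,
    hT.replace_module hM (hCA.trans hAM) (indep_sub C hCA) hC, ?_,
    by rwa [card_replace_module (hBA.trans hAM) hB],
    by rwa [card_replace_module (hCA.trans hAM) hC]⟩
  calc (symmDiff (S \ M ∪ B) (T \ M ∪ C)).card
      ≤ (symmDiff S T \ M ∪ symmDiff B C).card := by
        apply card_le_card
        intro x
        simp only [mem_symmDiff, mem_union, mem_sdiff]
        tauto
    _ ≤ (symmDiff S T \ M).card + (symmDiff B C).card := card_union_le _ _
    _ ≤ (symmDiff S T \ M).card + (symmDiff S T ∩ M).card := by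
        have hinter : symmDiff (S ∩ M) (T ∩ M) = symmDiff S T ∩ M := by
          ext x
          simp only [mem_symmDiff, mem_inter]
          tauto
        rw [hBC, hB, ← hinter]
        gcongr
        exact card_sub_add_card_sub_le_card_symmDiff _ _
    _ = (symmDiff S T).card := card_sdiff_add_card_inter _ _
    _ ≤ 1 := hST

/-- Let `G` be a finite simple graph, `S` an independent set of
`G`, `k` an integer, and `M` a module of `G`. Suppose there exists an
independent set `A ⊆ M` with `S ∩ M ⊆ A` and `A` a maximum independent set of
`G[M]`. Then for every `u ∈ M \ A`, `λ(G, S, k) = λ(G - u, S, k)`. -/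
theorem stmt4 {V : Type*} [Fintype V] [DecidableEq V] (G : SimpleGraph V)
    (S : Finset V) (hS : IndepF G S) (k : ℤ)
    (M : Finset V) (hM : IsModule G M)
    (A : Finset V) (hAM : A ⊆ M) (hAind : IndepF G A) (hSA : S ∩ M ⊆ A)
    (hAmax : ∀ B : Finset V, B ⊆ M → IndepF G B → B.card ≤ A.card)
    (u : V) (huM : u ∈ M) (huA : u ∉ A) :
    lam G Set.univ S k = lam G ({u}ᶜ : Set V) S k := by
  unfold lam
  congr 1
  ext n
  constructor
  · rintro ⟨T, hT, rfl⟩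
    suffices h : ∃ B ⊆ A, B.card = (T ∩ M).card ∧
        TarReachOn G ({u}ᶜ : Set V) k S (T \ M ∪ B) by
      obtain ⟨B, hBA, hB, hreach⟩ := h
      exact ⟨_, hreach, card_replace_module (hBA.trans hAM) hB⟩
    induction hT with
    | refl =>
      refine ⟨S ∩ M, hSA, rfl, ?_⟩
      rw [sdiff_union_inter]
      exact Relation.ReflTransGen.refl
    | tail _ hstep ih =>
      obtain ⟨B, hBA, hB, hreach⟩ := ih
      obtain ⟨C, hCA, hC, hBC⟩ :=
        hstep.exists_replace_module hM hAM hAind hAmax huM huA hBA hB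
      exact ⟨C, hCA, hC, hreach.tail hBC⟩
  · rintro ⟨T, hT, rfl⟩
    exact ⟨T, hT.mono (Set.subset_univ _), rfl⟩
end

section
/- Let G be a finite simple graph, M a module of G, and S an independent set of G with |S ∩ M| ≥ 2. Then for every independent set S' of G: S ↭ S' in G (under token sliding) if and only if S' ∩ N(M) = ∅ and S ↭ S' in the induced subgraph G − N(M). -/
open Finset

variable {V : Type*}

/-- A token-sliding step moves one token from a vertex `x` to an adjacent vertex `y`. -/
theorem TsStepOn.exists_move {V : Type*} [DecidableEq V] {G : SimpleGraph V} {W : Set V}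
    {A B : Finset V} (h : TsStepOn G W A B) :
    ∃ x y, G.Adj x y ∧ x ∈ A ∧ y ∈ B ∧ ∀ z ∈ A, z ≠ x → z ∈ B := by
  obtain ⟨-, -, hA, hB, x, y, hxy, hd⟩ := h
  have key : ∀ z, (z ∈ A ∧ z ∉ B ∨ z ∈ B ∧ z ∉ A) ↔ (z = x ∨ z = y) := by
    intro z
    rw [← mem_symmDiff, hd, mem_insert, mem_singleton]
  have hx := (key x).2 (Or.inl rfl)
  have hy := (key y).2 (Or.inr rfl)
  rcases hx with hx | hx <;> rcases hy with hy | hy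
  · exact absurd hxy (hA x hx.1 y hy.1)
  · exact ⟨x, y, hxy, hx.1, hy.1, by grind⟩
  · exact ⟨y, x, hxy.symm, hy.1, hx.1, by grind⟩
  · exact absurd hxy (hB x hx.1 y hy.1)

/-- An independent set meeting a module `M` avoids the neighborhood of `M`. -/
theorem IndepF.subset_compl_nbhdSet {V : Type*} [DecidableEq V] {G : SimpleGraph V}
    {M A : Finset V} (hM : IsModule G M) (hA : IndepF G A) (hAM : (A ∩ M).Nonempty) :
    (A : Set V) ⊆ (NbhdSet G M)ᶜ := by
  obtain ⟨a, ha⟩ := hAM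
  rw [mem_inter] at ha
  rintro w hw ⟨hwM, v, hv, hvw⟩
  exact hA a ha.1 w hw ((hM v hv a ha.2 w hwM).1 hvw)

/-- Token-sliding steps preserve the property of having at least two tokens on a module. -/
theorem TsStepOn.two_le_card_inter {V : Type*} [DecidableEq V] {G : SimpleGraph V} {W : Set V}
    {M A B : Finset V} (hM : IsModule G M) (h : TsStepOn G W A B) (hAM : 2 ≤ (A ∩ M).card) :
    2 ≤ (B ∩ M).card := by
  obtain ⟨x, y, hxy, hx, hy, hmove⟩ := h.exists_move
  obtain ⟨-, -, hA, hB, -⟩ := h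
  have hyA : y ∉ A := fun hyA => hA x hx y hyA hxy
  obtain ⟨a, ha, b, hb, hab⟩ := one_lt_card.1 hAM
  rw [mem_inter] at ha hb
  have hyM : x ∈ M → y ∈ M := by
    intro hxM
    by_contra hyM
    have hn : ∀ z ∈ A, z ∈ M → z = x := fun z hz hzM => by
      by_contra hzx
      exact hB z (hmove z hz hzx) y hy ((hM x hxM z hzM y hyM).1 hxy)
    exact hab ((hn a ha.1 ha.2).trans (hn b hb.1 hb.2).symm)
  refine one_lt_card.2 ?_
  simp only [mem_inter]
  by_cases hax : a = x
  · subst hax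
    exact ⟨y, ⟨hy, hyM ha.2⟩, b, ⟨hmove b hb.1 hab.symm, hb.2⟩, by grind⟩
  by_cases hbx : b = x
  · subst hbx
    exact ⟨a, ⟨hmove a ha.1 hab, ha.2⟩, y, ⟨hy, hyM hb.2⟩, by grind⟩
  exact ⟨a, ⟨hmove a ha.1 hax, ha.2⟩, b, ⟨hmove b hb.1 hbx, hb.2⟩, hab⟩

/-- Let `M` be a module of `G` and `S` an independent set of `G`
with `|S ∩ M| ≥ 2`. Then for every independent set `S'` of `G`: `S ↭ S'` in
`G` under token sliding iff `S' ∩ N(M) = ∅` and `S ↭ S'` in `G - N(M)`. -/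
theorem stmt7 {V : Type*} [Fintype V] [DecidableEq V] (G : SimpleGraph V)
    (M : Finset V) (hM : IsModule G M)
    (S : Finset V) (hS : IndepF G S) (hSM : 2 ≤ (S ∩ M).card)
    (S' : Finset V) (hS' : IndepF G S') :
    TsReachOn G Set.univ S S' ↔
      ((S' : Set V) ∩ NbhdSet G M = ∅ ∧ TsReachOn G (NbhdSet G M)ᶜ S S') := by
  constructor
  · intro h
    have key : TsReachOn G (NbhdSet G M)ᶜ S S' ∧ 2 ≤ (S' ∩ M).card := by
      clear hS'
      induction h with
      | refl => exact ⟨Relation.ReflTransGen.refl, hSM⟩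
      | tail _ hstep ih =>
        obtain ⟨hreach, hcard⟩ := ih
        have hcard' := hstep.two_le_card_inter hM hcard
        obtain ⟨-, -, hA, hB, hd⟩ := hstep
        exact ⟨hreach.tail ⟨hA.subset_compl_nbhdSet hM (card_pos.1 (by omega)),
          hB.subset_compl_nbhdSet hM (card_pos.1 (by omega)), hA, hB, hd⟩, hcard'⟩
    exact ⟨Set.disjoint_iff_inter_eq_empty.1 (Set.subset_compl_iff_disjoint_right.1
      (hS'.subset_compl_nbhdSet hM (card_pos.1 (by omega)))), key.1⟩
  · rintro ⟨-, h⟩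
    exact Relation.ReflTransGen.mono (fun _ _ hstep =>
      ⟨Set.subset_univ _, Set.subset_univ _, hstep.2.2⟩) _ _ h
end

section
/- Let G be a finite simple graph, M a module of G, and S an independent set of G such that |S ∩ M| ≤ 1. Then every independent set S' of G with S ↭ S' (under token sliding) satisfies |S' ∩ M| ≤ 1. -/
open Finset

variable {V : Type*}

/-- A token-sliding step preserves the property of meeting a module in at most one vertex. -/
theorem TsStepOn.card_inter_module_le_one [DecidableEq V] {G : SimpleGraph V} {W : Set V}
    {M A B : Finset V} (hM : IsModule G M) (h : TsStepOn G W A B) (hA : (A ∩ M).card ≤ 1) :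
    (B ∩ M).card ≤ 1 := by
  obtain ⟨-, -, hIA, hIB, x, y, hxy, hd⟩ := h
  have hmem : ∀ z, (z ∈ A ∧ z ∉ B ∨ z ∈ B ∧ z ∉ A) ↔ z = x ∨ z = y := fun z => by
    rw [← mem_symmDiff, hd, mem_insert, mem_singleton]
  -- The vertex that left `A` is adjacent to the vertex that entered `B`.
  obtain ⟨p, q, hpq, hpA, hpB, hB⟩ : ∃ p q, G.Adj q p ∧ p ∈ A ∧ p ∉ B ∧
      ∀ z ∈ B, z = q ∨ z ∈ A := by
    have hxA := hIA x
    have hxB := hIB x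
    have hx := (hmem x).2 (Or.inl rfl)
    have hy := (hmem y).2 (Or.inr rfl)
    by_cases hxA' : x ∈ A
    · exact ⟨x, y, hxy.symm, by grind⟩
    · exact ⟨y, x, hxy, by grind⟩
  rw [card_le_one] at hA ⊢
  simp only [mem_inter] at hA ⊢
  have key : ∀ b ∈ B, b ∈ M → q ∈ M → b ∈ A → False := fun b hbB hbM hqM hbA => by
    by_cases hpM : p ∈ M
    · exact hpB (hA b ⟨hbA, hbM⟩ p ⟨hpA, hpM⟩ ▸ hbB)
    · exact hIA b hbA p hpA ((hM q hqM b hbM p hpM).1 hpq)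
  rintro a ⟨haB, haM⟩ b ⟨hbB, hbM⟩
  rcases hB a haB with rfl | haA <;> rcases hB b hbB with rfl | hbA
  · rfl
  · exact (key b hbB hbM haM hbA).elim
  · exact (key a haB haM hbM haA).elim
  · exact hA a ⟨haA, haM⟩ b ⟨hbA, hbM⟩

/-- Let `M` be a module of `G` and `S` an independent set of `G`
with `|S ∩ M| ≤ 1`. Then every independent set `S'` of `G` with `S ↭ S'`
under token sliding satisfies `|S' ∩ M| ≤ 1`. -/
theorem stmt8 {V : Type*} [Fintype V] [DecidableEq V] (G : SimpleGraph V)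
    (M : Finset V) (hM : IsModule G M)
    (S : Finset V) (hS : IndepF G S) (hSM : (S ∩ M).card ≤ 1)
    (S' : Finset V) (hS' : IndepF G S')
    (h : TsReachOn G Set.univ S S') :
    (S' ∩ M).card ≤ 1 := by
  induction h with
  | refl => exact hSM
  | tail _ hstep ih => exact hstep.card_inter_module_le_one hM (ih hstep.2.2.1)
end

section
/- Let G be a finite simple graph, k an integer, and S an independent set of G that has maximum size among all independent sets TAR_k-reachable from S (i.e., |S| = λ(G, S, k)). Then for every independent set S' of G with S ↭_k S' and for every connected component C of G, |S' ∩ C| ≤ |S ∩ C|. -/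
open Finset

variable {V : Type*}

open scoped Classical in
/-- The set that agrees with `A` on the component `c` and with `S` elsewhere. -/
noncomputable def spliceOn [DecidableEq V] (G : SimpleGraph V) (c : G.ConnectedComponent)
    (S A : Finset V) : Finset V :=
  A.filter (fun x => G.connectedComponentMk x = c) ∪
    S.filter (fun x => ¬ G.connectedComponentMk x = c)

theorem mem_spliceOn [DecidableEq V] {G : SimpleGraph V} {c : G.ConnectedComponent}
    {S A : Finset V} {x : V} :
    x ∈ spliceOn G c S A ↔ (x ∈ A ∧ G.connectedComponentMk x = c) ∨
      (x ∈ S ∧ ¬ G.connectedComponentMk x = c) := by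
  simp [spliceOn]

open scoped Classical in
theorem card_spliceOn [DecidableEq V] (G : SimpleGraph V) (c : G.ConnectedComponent)
    (S A : Finset V) :
    (spliceOn G c S A).card = (A.filter (fun x => G.connectedComponentMk x = c)).card +
      (S.filter (fun x => ¬ G.connectedComponentMk x = c)).card :=
  card_union_of_disjoint <| disjoint_left.2 fun _ h h' => (mem_filter.1 h').2 (mem_filter.1 h).2

theorem spliceOn_self [DecidableEq V] (G : SimpleGraph V) (c : G.ConnectedComponent)
    (S : Finset V) : spliceOn G c S S = S := by
  ext x
  rw [mem_spliceOn]
  tauto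

theorem IndepF.spliceOn [DecidableEq V] {G : SimpleGraph V} {S A : Finset V}
    (hS : IndepF G S) (hA : IndepF G A) (c : G.ConnectedComponent) :
    IndepF G (spliceOn G c S A) := by
  intro u hu v hv huv
  have hcomp : G.connectedComponentMk u = G.connectedComponentMk v :=
    SimpleGraph.ConnectedComponent.sound huv.reachable
  rw [mem_spliceOn] at hu hv
  rcases hu with ⟨hu, hu'⟩ | ⟨hu, hu'⟩ <;> rcases hv with ⟨hv, hv'⟩ | ⟨hv, hv'⟩
  · exact hA u hu v hv huv
  · exact hv' (hcomp ▸ hu')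
  · exact hu' (hcomp ▸ hv')
  · exact hS u hu v hv huv

theorem symmDiff_spliceOn_subset [DecidableEq V] (G : SimpleGraph V)
    (c : G.ConnectedComponent) (S A B : Finset V) :
    symmDiff (spliceOn G c S A) (spliceOn G c S B) ⊆ symmDiff A B := by
  intro x
  simp only [mem_symmDiff, mem_spliceOn]
  tauto

open scoped Classical in
theorem card_filter_not_le_of_forall_component {G : SimpleGraph V} [Fintype V]
    {S A : Finset V}
    (h : ∀ c : G.ConnectedComponent,
      (A.filter (fun x => G.connectedComponentMk x = c)).card ≤
        (S.filter (fun x => G.connectedComponentMk x = c)).card)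
    (c : G.ConnectedComponent) :
    (A.filter (fun x => ¬ G.connectedComponentMk x = c)).card ≤
      (S.filter (fun x => ¬ G.connectedComponentMk x = c)).card := by
  have key (T : Finset V) : (T.filter (fun x => ¬ G.connectedComponentMk x = c)).card =
      ∑ d ∈ univ.erase c, (T.filter (fun x => G.connectedComponentMk x = d)).card := by
    rw [card_eq_sum_card_fiberwise (f := G.connectedComponentMk) (t := univ.erase c)
      (fun x hx => mem_erase.2 ⟨(mem_filter.1 hx).2, mem_univ _⟩)]
    refine sum_congr rfl fun d hd => ?_
    rw [filter_filter]
    congr 1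
    refine filter_congr fun x _ => ?_
    have := ne_of_mem_erase hd
    constructor
    · exact And.right
    · rintro rfl
      exact ⟨this, rfl⟩
  rw [key, key]
  exact sum_le_sum fun d _ => h d

/-- If a step removes a vertex satisfying `p`, it adds no vertex violating `p`. -/
theorem card_filter_not_le_of_card_filter_lt [DecidableEq V] {A B : Finset V}
    (h : (symmDiff A B).card ≤ 1) (p : V → Prop) [DecidablePred p]
    (hlt : (B.filter p).card < (A.filter p).card) :
    (B.filter (fun x => ¬ p x)).card ≤ (A.filter (fun x => ¬ p x)).card := by
  obtain ⟨x, hxA, hxB⟩ := exists_mem_notMem_of_card_lt_card hlt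
  rw [mem_filter] at hxA hxB
  refine card_le_card fun y hy => ?_
  rw [mem_filter] at hy ⊢
  refine ⟨by_contra fun hyA => hy.2 ?_, hy.2⟩
  have hx : x ∈ symmDiff A B := mem_symmDiff.2 (Or.inl ⟨hxA.1, fun h => hxB ⟨h, hxA.2⟩⟩)
  have hy' : y ∈ symmDiff A B := mem_symmDiff.2 (Or.inr ⟨hy.1, hyA⟩)
  exact card_le_one.1 h x hx y hy' ▸ hxA.2

open scoped Classical in
theorem TarStepOn.spliceOn [Fintype V] [DecidableEq V] {G : SimpleGraph V} {k : ℤ}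
    {S A B : Finset V} (hS : IndepF G S) (h : TarStepOn G Set.univ k A B)
    (hA : ∀ c : G.ConnectedComponent,
      (A.filter (fun x => G.connectedComponentMk x = c)).card ≤
        (S.filter (fun x => G.connectedComponentMk x = c)).card)
    (c : G.ConnectedComponent) :
    TarStepOn G Set.univ k (spliceOn G c S A) (spliceOn G c S B) := by
  obtain ⟨-, -, hAi, hBi, hd, hkA, hkB⟩ := h
  refine ⟨Set.subset_univ _, Set.subset_univ _, hS.spliceOn hAi c, hS.spliceOn hBi c,
    (card_le_card (symmDiff_spliceOn_subset G c S A B)).trans hd, ?_, ?_⟩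
  all_goals
    have hout := card_filter_not_le_of_forall_component hA c
    have hcA := card_filter_add_card_filter_not (s := A) (fun x => G.connectedComponentMk x = c)
    have hcB := card_filter_add_card_filter_not (s := B) (fun x => G.connectedComponentMk x = c)
    rw [card_spliceOn]
  · omega
  · have := card_filter_not_le_of_card_filter_lt hd (fun x => G.connectedComponentMk x = c)
    omega

theorem TarReachOn.card_le_lam [Fintype V] [DecidableEq V] {G : SimpleGraph V} {W : Set V}
    {k : ℤ} {S T : Finset V} (h : TarReachOn G W k S T) : T.card ≤ lam G W S k :=
  le_csSup ⟨Fintype.card V, by rintro _ ⟨U, -, rfl⟩; exact card_le_univ U⟩ ⟨T, h, rfl⟩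

open scoped Classical in
/-- Let `S` be an independent set of `G` of maximum size among
all independent sets `TAR_k`-reachable from `S` (i.e. `|S| = λ(G,S,k)`). Then
for every independent set `S'` with `S ↭_k S'` and every connected component
`C` of `G`, `|S' ∩ C| ≤ |S ∩ C|`. -/
theorem stmt14 {V : Type*} [Fintype V] [DecidableEq V] (G : SimpleGraph V)
    (k : ℤ) (S : Finset V) (hS : IndepF G S)
    (hmax : S.card = lam G Set.univ S k)
    (S' : Finset V) (hS' : IndepF G S')
    (hreach : TarReachOn G Set.univ k S S') :
    ∀ c : G.ConnectedComponent,
      (S'.filter (fun x => G.connectedComponentMk x = c)).card ≤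
        (S.filter (fun x => G.connectedComponentMk x = c)).card := by
  suffices h : ∀ c : G.ConnectedComponent,
      (S'.filter (fun x => G.connectedComponentMk x = c)).card ≤
        (S.filter (fun x => G.connectedComponentMk x = c)).card ∧
      TarReachOn G Set.univ k S (spliceOn G c S S') from fun c => (h c).1
  clear hS'
  induction hreach with
  | refl => exact fun c => ⟨le_rfl, by rw [spliceOn_self]; exact Relation.ReflTransGen.refl⟩
  | @tail A B _ hstep ih =>
    intro c
    have hB : TarReachOn G Set.univ k S (spliceOn G c S B) :=
      (ih c).2.tail (hstep.spliceOn hS (fun d => (ih d).1) c)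
    refine ⟨?_, hB⟩
    have hle := hB.card_le_lam
    rw [← hmax, card_spliceOn,
      ← card_filter_add_card_filter_not (s := S) (fun x => G.connectedComponentMk x = c)] at hle
    omega
end

section
/- Let G be a finite simple graph, M a module of G, and S' an independent set of G with M ∩ S' = {v}. If u ∈ M lies in the same connected component of the induced subgraph G[M] as v, then (S' ∖ {v}) ∪ {u} ↭ S' in G under token sliding. -/
open Finset

variable {V : Type*}

/-- Replacing the only vertex `v` of `S` in a module `M` by another vertex of `M`
preserves independence. -/
lemma IndepF.replace_in_module [DecidableEq V] {G : SimpleGraph V} {M S : Finset V}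
    (hM : IsModule G M) (hS : IndepF G S) {v a : V} (hSv : M ∩ S = {v}) (ha : a ∈ M) :
    IndepF G ((S \ {v}) ∪ {a}) := by
  have hv : v ∈ M ∩ S := by simp [hSv]
  obtain ⟨hvM, hvS⟩ := mem_inter.mp hv
  have hadj : ∀ w ∈ S \ {v}, ¬ G.Adj a w := by
    intro w hw
    rw [mem_sdiff, mem_singleton] at hw
    have hwM : w ∉ M := fun h => hw.2 (by
      have := mem_inter.mpr ⟨h, hw.1⟩
      rwa [hSv, mem_singleton] at this)
    rw [hM a ha v hvM w hwM]
    exact hS v hvS w hw.1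
  intro x hx y hy hxy
  rw [mem_union, mem_singleton] at hx hy
  rcases hx with hx | rfl <;> rcases hy with hy | rfl
  · exact hS x (mem_sdiff.mp hx).1 y (mem_sdiff.mp hy).1 hxy
  · exact hadj x hx hxy.symm
  · exact hadj y hy hxy
  · exact G.loopless.irrefl _ hxy

/-- Sliding the only token of `S` in a module `M` along an edge of `G[M]` is a valid step. -/
lemma tsStepOn_replace_in_module [DecidableEq V] {G : SimpleGraph V} {M S : Finset V}
    (hM : IsModule G M) (hS : IndepF G S) {v a b : V} (hSv : M ∩ S = {v})
    (ha : a ∈ M) (hb : b ∈ M) (hab : G.Adj a b) :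
    TsStepOn G Set.univ ((S \ {v}) ∪ {a}) ((S \ {v}) ∪ {b}) := by
  refine ⟨Set.subset_univ _, Set.subset_univ _, hS.replace_in_module hM hSv ha,
    hS.replace_in_module hM hSv hb, a, b, hab, ?_⟩
  have hnot : ∀ c ∈ M, c ∉ S \ {v} := by
    intro c hc h
    rw [mem_sdiff, ← hSv, mem_inter] at h
    exact h.2 ⟨hc, h.1⟩
  have hna := hnot a ha
  have hnb := hnot b hb
  have hne := hab.ne
  ext x
  simp only [mem_symmDiff, mem_union, mem_singleton, mem_insert]
  grind

/-- Let `M` be a module of `G` and `S'` an independent set of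
`G` with `M ∩ S' = {v}`. If `u ∈ M` lies in the same connected component of
`G[M]` as `v`, then `(S' \ {v}) ∪ {u} ↭ S'` in `G` under token sliding. -/
theorem stmt18 {V : Type*} [Fintype V] [DecidableEq V] (G : SimpleGraph V)
    (M : Finset V) (hM : IsModule G M)
    (S' : Finset V) (hS' : IndepF G S')
    (v : V) (hvM : v ∈ M) (hS'v : M ∩ S' = {v})
    (u : V) (huM : u ∈ M)
    (hcomp : (G.induce {x : V | x ∈ M}).Reachable ⟨u, huM⟩ ⟨v, hvM⟩) :
    TsReachOn G Set.univ ((S' \ {v}) ∪ {u}) S' := by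
  have hv : v ∈ S' := (mem_inter.mp (hS'v ▸ mem_singleton_self v)).2
  have key : ∀ a b : {x : V | x ∈ M}, (G.induce {x : V | x ∈ M}).Walk a b →
      TsReachOn G Set.univ ((S' \ {v}) ∪ {a.1}) ((S' \ {v}) ∪ {b.1}) := by
    intro a b p
    induction p with
    | nil => exact Relation.ReflTransGen.refl
    | @cons x y z h _ ih =>
      exact Relation.ReflTransGen.head
        (tsStepOn_replace_in_module hM hS' hS'v x.2 y.2 h) ih
  obtain ⟨p⟩ := hcomp
  have h := key _ _ p
  rwa [sdiff_union_of_subset (singleton_subset_iff.mpr hv)] at h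
end
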